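/- arXiv:0706.3405 — 3 statements merged into one kernel-verified Lean document; each statement's English description precedes it below -/
import Mathlib

section
/- For any n ≥ 2, f(n,2) ≤ min over k + l + m = n − 2 (k, l, m ≥ 0) of ( f(k,2) + f(l,2) + f(m,2) ) + ⌊3n/2⌋, where f(n,2) is the supremum of τ(𝓑) over finite families of axis-parallel rectangles in ℝ² with ν(𝓑) ≤ n. -/
/-- A finite point set `S` pierces the family `F` if every member contains a point of `S`. -/
def Piercing {α : Type*} (S : Finset α) (F : Finset (Set α)) : Prop :=
  ∀ B ∈ F, ∃ p ∈ S, p ∈ B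

/-- The piercing (transversal) number τ of a finite family of sets. -/
noncomputable def tau {α : Type*} (F : Finset (Set α)) : ℕ :=
  sInf {n | ∃ S : Finset α, S.card = n ∧ Piercing S F}

/-- The independence number ν : the maximal number of pairwise disjoint members. -/
noncomputable def nu {α : Type*} (F : Finset (Set α)) : ℕ :=
  sSup {n | ∃ G ⊆ F, G.card = n ∧ (G : Set (Set α)).PairwiseDisjoint id}

/-- An axis-parallel box in ℝ^d : a product of d nonempty closed intervals. -/
def IsBox (d : ℕ) (B : Set (Fin d → ℝ)) : Prop :=
  ∃ l u : Fin d → ℝ, l ≤ u ∧ B = Set.Icc l u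

/-- `f n d` : the supremum of τ over finite families of boxes in ℝ^d with ν ≤ n. -/
noncomputable def fBox (n d : ℕ) : ℕ :=
  sSup {t | ∃ F : Finset (Set (Fin d → ℝ)),
    (∀ B ∈ F, IsBox d B) ∧ nu F ≤ n ∧ tau F = t}

namespace BoxRec

/-- Every pairwise disjoint subfamily has at most `n` members. -/
def Ind {α : Type*} (F : Finset (Set α)) (n : ℕ) : Prop :=
  ∀ G ⊆ F, (G : Set (Set α)).PairwiseDisjoint id → G.card ≤ n

/-- `F` can be pierced by at most `t` points. -/
def Prc {α : Type*} (F : Finset (Set α)) (t : ℕ) : Prop :=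
  ∃ S : Finset α, S.card ≤ t ∧ Piercing S F

/-- `t` is a uniform bound for families with independence number at most `n`. -/
def Bd (n t : ℕ) : Prop :=
  ∀ F : Finset (Set (Fin 2 → ℝ)), (∀ B ∈ F, IsBox 2 B) → Ind F n → Prc F t

theorem ind_iff {α : Type*} (F : Finset (Set α)) (n : ℕ) : nu F ≤ n ↔ Ind F n := by
  unfold nu Ind
  constructor
  · intro h G hG hd
    have hm : G.card ∈ {n | ∃ G ⊆ F, G.card = n ∧ (G : Set (Set α)).PairwiseDisjoint id} :=
      ⟨G, hG, rfl, hd⟩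
    refine le_trans (le_csSup ⟨F.card, ?_⟩ hm) h
    rintro _ ⟨G', hG', rfl, -⟩
    exact Finset.card_le_card hG'
  · intro h
    apply csSup_le'
    rintro _ ⟨G, hG, rfl, hd⟩
    exact h G hG hd

theorem Ind.mono {α : Type*} {F F' : Finset (Set α)} {n : ℕ} (h : Ind F n) (hs : F' ⊆ F) :
    Ind F' n := fun G hG hd => h G (hG.trans hs) hd

open Classical in
theorem Prc.cover {α : Type*} {F F1 F2 : Finset (Set α)} {s t : ℕ} (h1 : Prc F1 s)
    (h2 : Prc F2 t) (h : ∀ B ∈ F, B ∈ F1 ∨ B ∈ F2) : Prc F (s + t) := by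
  obtain ⟨S, hS, hS'⟩ := h1
  obtain ⟨T, hT, hT'⟩ := h2
  refine ⟨S ∪ T, (Finset.card_union_le _ _).trans (by omega), fun B hB => ?_⟩
  rcases h B hB with h | h
  · obtain ⟨p, hp, hpB⟩ := hS' B h
    exact ⟨p, Finset.mem_union_left _ hp, hpB⟩
  · obtain ⟨p, hp, hpB⟩ := hT' B h
    exact ⟨p, Finset.mem_union_right _ hp, hpB⟩

theorem Prc.mono {α : Type*} {F : Finset (Set α)} {s t : ℕ} (h1 : Prc F s) (h : s ≤ t) :
    Prc F t := by
  obtain ⟨S, hS, hS'⟩ := h1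
  exact ⟨S, hS.trans h, hS'⟩

open Classical in
/-- Separated subfamilies: independence numbers add. -/
theorem sep {α : Type*} {F F1 F2 : Finset (Set α)} {n k l : ℕ} (hF : Ind F n)
    (h1 : F1 ⊆ F) (h2 : F2 ⊆ F) (hne : ∀ B ∈ F, B.Nonempty)
    (hd : ∀ B ∈ F1, ∀ C ∈ F2, Disjoint B C) (hk : ¬ Ind F1 k) (hn : n ≤ k + 1 + l) :
    Ind F2 l := by
  intro G hG hGd
  unfold Ind at hk
  push Not at hk
  obtain ⟨H, hH, hHd, hc⟩ := hk
  have hdis : Disjoint H G := by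
    rw [Finset.disjoint_left]
    intro B hB hB'
    have := hd B (hH hB) B (hG hB')
    rw [disjoint_self] at this
    exact (hne B (h1 (hH hB))).ne_empty this
  have := hF (H ∪ G) (Finset.union_subset (hH.trans h1) (hG.trans h2)) (by
    rw [Finset.coe_union]
    refine (Set.pairwiseDisjoint_union).2 ⟨hHd, hGd, ?_⟩
    intro B hB C hC _
    exact hd B (hH hB) C (hG hC))
  rw [Finset.card_union_of_disjoint hdis] at this
  omega

open Classical in
/-- Choice of a threshold. -/
theorem threshold {α : Type*} {F : Finset (Set α)} {k : ℕ} (g : Set α → ℝ) (h : ¬ Ind F k) :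
    ∃ a, Ind (F.filter (fun B => g B < a)) k ∧ ¬ Ind (F.filter (fun B => g B ≤ a)) k := by
  have key : ∀ F' ⊆ F, ¬ Ind F' k →
      ∃ B ∈ F', ¬ Ind (F.filter (fun C => g C ≤ g B)) k := by
    intro F' hs hF'
    have hne : F'.Nonempty := by
      rw [Finset.nonempty_iff_ne_empty]
      rintro rfl
      exact hF' (fun G hG _ => by simp [Finset.subset_empty.1 hG])
    obtain ⟨B, hB, hmax⟩ := Finset.exists_max_image F' g hne
    refine ⟨B, hB, fun hI => hF' (hI.mono fun C hC => ?_)⟩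
    exact Finset.mem_filter.2 ⟨hs hC, hmax C hC⟩
  obtain ⟨B0, hB0, hB0'⟩ := key F subset_rfl h
  obtain ⟨B, hB, hmin⟩ := Finset.exists_min_image
    (F.filter (fun B => ¬ Ind (F.filter (fun C => g C ≤ g B)) k)) g
    ⟨B0, Finset.mem_filter.2 ⟨hB0, hB0'⟩⟩
  refine ⟨g B, ?_, (Finset.mem_filter.1 hB).2⟩
  by_contra hcon
  obtain ⟨C, hC, hC'⟩ := key _ (Finset.filter_subset _ _) hcon
  rw [Finset.mem_filter] at hC
  have := hmin C (Finset.mem_filter.2 ⟨hC.1, hC'⟩)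
  linarith [hC.2]

theorem corners : ∃ lo hi : Set (Fin 2 → ℝ) → Fin 2 → ℝ,
    ∀ B, IsBox 2 B → lo B ≤ hi B ∧ B = Set.Icc (lo B) (hi B) := by
  have : ∀ B : Set (Fin 2 → ℝ), ∃ l u : Fin 2 → ℝ, IsBox 2 B → l ≤ u ∧ B = Set.Icc l u := by
    intro B
    by_cases h : IsBox 2 B
    · obtain ⟨l, u, h⟩ := h
      exact ⟨l, u, fun _ => h⟩
    · exact ⟨0, 0, fun h' => absurd h' h⟩
  choose lo hi h using this
  exact ⟨lo, hi, h⟩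

theorem box_nonempty {B : Set (Fin 2 → ℝ)} (h : IsBox 2 B) : B.Nonempty := by
  obtain ⟨l, u, h, rfl⟩ := h
  exact Set.nonempty_Icc.2 h

theorem bd_zero : Bd 0 0 := by
  intro F _ hI
  refine ⟨∅, le_rfl, fun B hB => ?_⟩
  have := hI {B} (by simpa using hB) (by simp)
  simp at this

open Classical in
theorem bd_one : Bd 1 1 := by
  intro F hF hI
  obtain ⟨lo, hi, hc⟩ := corners
  rcases F.eq_empty_or_nonempty with rfl | hne
  · exact ⟨∅, by simp, fun B hB => by simp at hB⟩
  refine ⟨{F.sup' hne lo}, by simp, fun B hB => ⟨_, Finset.mem_singleton_self _, ?_⟩⟩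
  rw [(hc B (hF B hB)).2]
  refine ⟨Finset.le_sup' lo hB, Finset.sup'_le _ _ fun C hC => ?_⟩
  by_cases hBC : C = B
  · subst hBC; exact (hc C (hF C hC)).1
  have hnd : ¬ Disjoint C B := by
    intro hd
    have := hI {C, B} (by
      intro X hX
      simp only [Finset.mem_insert, Finset.mem_singleton] at hX
      rcases hX with rfl | rfl <;> assumption) (by
      rw [Finset.coe_insert, Finset.coe_singleton]
      intro X hX Y hY hXY
      simp only [Set.mem_insert_iff, Set.mem_singleton_iff] at hX hY
      rcases hX with rfl | rfl <;> rcases hY with rfl | rfl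
      · exact absurd rfl hXY
      · exact hd
      · exact hd.symm
      · exact absurd rfl hXY)
    rw [Finset.card_pair hBC] at this
    omega
  obtain ⟨x, hx, hx'⟩ := Set.not_disjoint_iff.1 hnd
  rw [(hc C (hF C hC)).2] at hx
  rw [(hc B (hF B hB)).2] at hx'
  exact hx.1.trans hx'.2

/-- Two boxes with a gap in some coordinate are disjoint. -/
theorem gap {l u l' u' : Fin 2 → ℝ} (i : Fin 2) (h : u i < l' i) :
    Disjoint (Set.Icc l u) (Set.Icc l' u') := by
  rw [Set.disjoint_left]
  intro x hx hx'
  have h1 := hx.2 i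
  have h2 := hx'.1 i
  linarith

open Classical in
/-- Two-line lemma. -/
theorem two_line (lo hi : Set (Fin 2 → ℝ) → Fin 2 → ℝ)
    (hc : ∀ B, IsBox 2 B → lo B ≤ hi B ∧ B = Set.Icc (lo B) (hi B)) (a b : ℝ) (n : ℕ) :
    ∀ F : Finset (Set (Fin 2 → ℝ)), (∀ B ∈ F, IsBox 2 B) →
      (∀ B ∈ F, (lo B 0 ≤ a ∧ a ≤ hi B 0) ∨ (lo B 0 ≤ b ∧ b ≤ hi B 0)) →
      Ind F n → Prc F (3 * n / 2) := by
  induction n using Nat.strong_induction_on with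
  | _ n ih =>
  intro F hF hl hI
  by_cases h1 : Ind F 1
  · by_cases hn : n = 0
    · subst hn; exact bd_zero F hF hI
    · exact (bd_one F hF h1).mono (by omega)
  have hn : 2 ≤ n := by
    by_contra hcon
    exact h1 fun G hG hd => (hI G hG hd).trans (by omega)
  obtain ⟨t, ht, ht'⟩ := threshold (fun B => hi B 1) h1
  have hup : Ind (F.filter (fun B => t < lo B 1)) (n - 2) := by
    refine sep hI (Finset.filter_subset _ _) (Finset.filter_subset _ _)
      (fun B hB => box_nonempty (hF B hB)) ?_ ht' (by omega)
    intro B hB C hC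
    rw [Finset.mem_filter] at hB hC
    rw [(hc B (hF B hB.1)).2, (hc C (hF C hC.1)).2]
    exact gap 1 (lt_of_le_of_lt hB.2 hC.2)
  have p1 := bd_one _ (fun B hB => hF B (Finset.mem_filter.1 hB).1) ht
  have p2 := ih (n - 2) (by omega) _ (fun B hB => hF B (Finset.mem_filter.1 hB).1)
    (fun B hB => hl B (Finset.mem_filter.1 hB).1) hup
  have p3 : Prc (F.filter (fun B => lo B 1 ≤ t ∧ t ≤ hi B 1)) 2 := by
    refine ⟨{![a, t], ![b, t]}, Finset.card_le_two, fun B hB => ?_⟩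
    rw [Finset.mem_filter] at hB
    have hB2 := (hc B (hF B hB.1)).2
    rcases hl B hB.1 with h | h
    · refine ⟨![a, t], by simp, ?_⟩
      rw [hB2]
      constructor <;> intro i <;> fin_cases i <;> simp <;> tauto
    · refine ⟨![b, t], by simp, ?_⟩
      rw [hB2]
      constructor <;> intro i <;> fin_cases i <;> simp <;> tauto
  have p12 := Prc.cover (F := F.filter (fun B => hi B 1 < t ∨ t < lo B 1)) p1 p2 (by
    intro B hB
    simp only [Finset.mem_filter] at hB ⊢
    tauto)
  refine (Prc.cover (F := F) p12 p3 ?_).mono (by omega)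
  intro B hB
  simp only [Finset.mem_filter, hB, true_and]
  by_cases h : hi B 1 < t ∨ t < lo B 1
  · exact Or.inl h
  · push Not at h; exact Or.inr ⟨h.2, h.1⟩

open Classical in
theorem bd_rec {n k l m A B C : ℕ} (hn : n = k + l + m + 2) (hA : Bd k A) (hB : Bd l B)
    (hC : Bd m C) : Bd n (A + B + C + 3 * n / 2) := by
  intro F hF hI
  obtain ⟨lo, hi, hc⟩ := corners
  by_cases hk : Ind F k
  · exact (hA F hF hk).mono (by omega)
  by_cases hm : Ind F m
  · exact (hC F hF hm).mono (by omega)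
  obtain ⟨a, ha, ha'⟩ := threshold (fun B => hi B 0) hk
  obtain ⟨b', hb, hb'⟩ := threshold (fun B => - lo B 0) hm
  obtain ⟨b, rfl⟩ : ∃ b, b' = -b := ⟨-b', by simp⟩
  have hbox : ∀ (p : Set (Fin 2 → ℝ) → Prop), ∀ X ∈ F.filter p, IsBox 2 X :=
    fun p X hX => hF X (Finset.mem_filter.1 hX).1
  have hmid : Ind (F.filter (fun X => a < lo X 0 ∧ hi X 0 < b)) l := by
    rcases lt_or_ge a b with hab | hab
    · have hr : Ind (F.filter (fun X => a < lo X 0)) (l + m + 1) := by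
        refine sep hI (Finset.filter_subset _ _) (Finset.filter_subset _ _)
          (fun X hX => box_nonempty (hF X hX)) ?_ ha' (by omega)
        intro X hX Y hY
        rw [Finset.mem_filter] at hX hY
        rw [(hc X (hF X hX.1)).2, (hc Y (hF Y hY.1)).2]
        exact gap 0 (lt_of_le_of_lt hX.2 hY.2)
      refine sep hr ?_ ?_ (fun X hX => box_nonempty (hbox _ X hX)) ?_ hb' (by omega)
      · intro X hX
        rw [Finset.mem_filter] at hX ⊢
        exact ⟨hX.1, by linarith [hX.2]⟩
      · intro X hX
        rw [Finset.mem_filter] at hX ⊢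
        exact ⟨hX.1, hX.2.1⟩
      · intro X hX Y hY
        rw [Finset.mem_filter] at hX hY
        rw [(hc X (hF X hX.1)).2, (hc Y (hF Y hY.1)).2]
        exact (gap 0 (by linarith [hX.2, hY.2.2])).symm
    · intro G hG _
      have : G = ∅ := by
        rw [Finset.eq_empty_iff_forall_notMem]
        intro X hX
        have hX := Finset.mem_filter.1 (hG hX)
        have := (hc X (hF X hX.1)).1 0
        linarith [hX.2.1, hX.2.2]
      simp [this]
  have pA := hA _ (hbox _) ha
  have pC := hC _ (hbox _) hb
  have pB := hB _ (fun X hX => hF X (Finset.mem_filter.1 hX).1) hmid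
  have pL := two_line lo hi hc a b n
    (F.filter (fun X => (lo X 0 ≤ a ∧ a ≤ hi X 0) ∨ (lo X 0 ≤ b ∧ b ≤ hi X 0)))
    (fun X hX => hF X (Finset.mem_filter.1 hX).1)
    (fun X hX => (Finset.mem_filter.1 hX).2) (hI.mono (Finset.filter_subset _ _))
  have pAB := Prc.cover (F := F.filter (fun X => hi X 0 < a ∨ (a < lo X 0 ∧ hi X 0 < b)))
    pA pB (by intro X hX; simp only [Finset.mem_filter] at hX ⊢; tauto)
  have pABC := Prc.cover (F := F.filter
    (fun X => (hi X 0 < a ∨ (a < lo X 0 ∧ hi X 0 < b)) ∨ - lo X 0 < -b))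
    pAB pC (by intro X hX; simp only [Finset.mem_filter] at hX ⊢; tauto)
  refine Prc.cover pABC pL ?_
  intro X hX
  simp only [Finset.mem_filter, hX, true_and, neg_lt_neg_iff]
  have h1 := lt_or_ge (hi X 0) a
  have h2 := lt_or_ge a (lo X 0)
  have h3 := lt_or_ge (hi X 0) b
  have h4 := lt_or_ge b (lo X 0)
  tauto

theorem exists_bd (n : ℕ) : ∃ t, Bd n t := by
  induction n using Nat.strong_induction_on with
  | _ n ih =>
  match n with
  | 0 => exact ⟨0, bd_zero⟩
  | 1 => exact ⟨1, bd_one⟩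
  | n + 2 =>
    obtain ⟨t, ht⟩ := ih n (by omega)
    exact ⟨_, bd_rec (by omega) ht bd_zero bd_zero⟩

theorem tau_le {α : Type*} {F : Finset (Set α)} {t : ℕ} (h : Prc F t) : tau F ≤ t := by
  obtain ⟨S, hS, hp⟩ := h
  have hm : S.card ∈ {n | ∃ S : Finset α, S.card = n ∧ Piercing S F} := ⟨S, rfl, hp⟩
  exact (Nat.sInf_le hm).trans hS

theorem prc_tau {α : Type*} {F : Finset (Set α)} {t : ℕ} (h : Prc F t) : Prc F (tau F) := by
  obtain ⟨S, hS, hp⟩ := h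
  obtain ⟨T, hT, hT'⟩ := Nat.sInf_mem
    (s := {n | ∃ S : Finset α, S.card = n ∧ Piercing S F}) ⟨_, S, rfl, hp⟩
  exact ⟨T, hT.le, hT'⟩

theorem fBox_le {n t : ℕ} (h : Bd n t) : fBox n 2 ≤ t := by
  apply csSup_le'
  rintro _ ⟨F, hF, hn, rfl⟩
  exact tau_le (h F hF ((ind_iff F n).1 hn))

theorem bd_fBox (n : ℕ) : Bd n (fBox n 2) := by
  obtain ⟨t, ht⟩ := exists_bd n
  intro F hF hI
  refine (prc_tau (ht F hF hI)).mono (le_csSup ⟨t, ?_⟩ ⟨F, hF, (ind_iff F n).2 hI, rfl⟩)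
  rintro _ ⟨F, hF, hn, rfl⟩
  exact tau_le (ht F hF ((ind_iff F n).1 hn))

end BoxRec

/-- Proposition 2: for n ≥ 2 and any k + l + m = n - 2,
f(n,2) ≤ f(k,2) + f(l,2) + f(m,2) + ⌊3n/2⌋. -/
theorem fBox_two_recursion (n : ℕ) (hn : 2 ≤ n)
    (k l m : ℕ) (hklm : k + l + m = n - 2) :
    fBox n 2 ≤ fBox k 2 + fBox l 2 + fBox m 2 + 3 * n / 2 :=
  BoxRec.fBox_le (BoxRec.bd_rec (by omega) (BoxRec.bd_fBox k) (BoxRec.bd_fBox l)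
    (BoxRec.bd_fBox m))
end

section
/- f(5,2) ≤ 10, i.e., any finite family of axis-parallel rectangles in ℝ² with no 6 pairwise disjoint members can be pierced by 10 points. -/
namespace BoxPierce

/-- Separation of two rectangles `[a,b] × [c,d]` in one of the two coordinates. -/
def Sep {ι : Type*} (a b c d : ι → ℝ) (i j : ι) : Prop :=
  b i < a j ∨ b j < a i ∨ d i < c j ∨ d j < c i

/-- No subfamily of pairwise `D`-related members has more than `m` elements. -/
def NuLe {ι : Type*} (D : ι → ι → Prop) (F : Finset ι) (m : ℕ) : Prop :=
  ∀ G ⊆ F, (∀ i ∈ G, ∀ j ∈ G, i ≠ j → D i j) → G.card ≤ m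

lemma NuLe.mono {ι : Type*} {D : ι → ι → Prop} {F F' : Finset ι} {m : ℕ}
    (h : NuLe D F m) (hs : F' ⊆ F) : NuLe D F' m :=
  fun G hG hD => h G (hG.trans hs) hD

open Classical in
/-- Cutting lemma: a hyperplane `t` with at most one independent member strictly below it,
and independence number at least two smaller strictly above it. -/
lemma cut {ι : Type*} (D : ι → ι → Prop) (hsymm : ∀ i j, D i j → D j i) (lo hi : ι → ℝ)
    (hD : ∀ i j, hi i < lo j → D i j) (F : Finset ι) (hle : ∀ i ∈ F, lo i ≤ hi i)
    (m : ℕ) (hF : NuLe D F m) :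
    ∃ t : ℝ, NuLe D (F.filter (fun i => hi i < t)) 1 ∧
      NuLe D (F.filter (fun i => t < lo i)) (m - 2) := by
  by_cases h1 : NuLe D F 1
  · obtain ⟨t, ht⟩ : ∃ t : ℝ, ∀ i ∈ F, lo i ≤ t := by
      obtain ⟨t, ht⟩ := (F.image lo).bddAbove
      exact ⟨t, fun i hi => ht (Finset.mem_coe.2 (Finset.mem_image_of_mem lo hi))⟩
    refine ⟨t, h1.mono (Finset.filter_subset _ _), ?_⟩
    intro G hG _
    have : G = ∅ := by
      apply Finset.eq_empty_of_forall_notMem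
      intro i hi
      have := Finset.mem_filter.1 (hG hi)
      exact absurd this.2 (not_lt.2 (ht i this.1))
    simp [this]
  · -- a subfamily without the bound 1 has a top value
    have key : ∀ F' ⊆ F, ¬ NuLe D F' 1 → ∃ j ∈ F', F' ⊆ F.filter (fun i => hi i ≤ hi j) := by
      intro F' hF' hn
      have hne : F'.Nonempty := by
        by_contra hcon
        rw [Finset.not_nonempty_iff_eq_empty] at hcon
        apply hn
        intro G hG _
        rw [hcon, Finset.subset_empty] at hG
        simp [hG]
      obtain ⟨j, hj, hmax⟩ := Finset.exists_max_image F' hi hne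
      exact ⟨j, hj, fun i hi' => Finset.mem_filter.2 ⟨hF' hi', hmax i hi'⟩⟩
    set T := F.filter (fun j => ¬ NuLe D (F.filter (fun i => hi i ≤ hi j)) 1) with hT
    have hTne : T.Nonempty := by
      obtain ⟨j, hj, hsub⟩ := key F (Finset.Subset.refl _) h1
      exact ⟨j, Finset.mem_filter.2 ⟨hj, fun hh => h1 (hh.mono hsub)⟩⟩
    obtain ⟨k, hk, hmin⟩ := Finset.exists_min_image T hi hTne
    obtain ⟨hkF, hk2⟩ := Finset.mem_filter.1 hk
    refine ⟨hi k, ?_, ?_⟩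
    · by_contra hcon
      obtain ⟨j, hj, hsub⟩ := key _ (Finset.filter_subset _ _) hcon
      obtain ⟨hjF, hjk⟩ := Finset.mem_filter.1 hj
      have : j ∈ T := Finset.mem_filter.2 ⟨hjF, fun hh => hcon (hh.mono hsub)⟩
      exact absurd (hmin j this) (not_le.2 hjk)
    · intro G hG hGD
      unfold NuLe at hk2
      push Not at hk2
      obtain ⟨G', hG', hGD', hc⟩ := hk2
      have hb : ∀ i ∈ G', i ∈ F ∧ hi i ≤ hi k := fun i h => Finset.mem_filter.1 (hG' h)
      have ha : ∀ i ∈ G, i ∈ F ∧ hi k < lo i := fun i h => Finset.mem_filter.1 (hG h)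
      have hdisj : Disjoint G G' := by
        rw [Finset.disjoint_left]
        intro i h h'
        have := hle i (ha i h).1
        linarith [(ha i h).2, (hb i h').2]
      have hcard := hF (G ∪ G') (by
        intro i h
        rcases Finset.mem_union.1 h with h | h
        · exact (ha i h).1
        · exact (hb i h).1) (by
        intro i h j h' hij
        rcases Finset.mem_union.1 h with h | h <;> rcases Finset.mem_union.1 h' with h' | h'
        · exact hGD i h j h' hij
        · exact hsymm _ _ (hD j i (lt_of_le_of_lt (hb j h').2 (ha i h).2))
        · exact hD i j (lt_of_le_of_lt (hb i h).2 (ha j h').2)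
        · exact hGD' i h j h' hij)
      rw [Finset.card_union_of_disjoint hdisj] at hcard
      omega

/-- Helly: pairwise intersecting rectangles share a point. -/
lemma helly {ι : Type*} (a b c d : ι → ℝ) (F : Finset ι)
    (hab : ∀ i ∈ F, a i ≤ b i) (hcd : ∀ i ∈ F, c i ≤ d i)
    (h : NuLe (Sep a b c d) F 1) :
    ∃ x y : ℝ, ∀ i ∈ F, a i ≤ x ∧ x ≤ b i ∧ c i ≤ y ∧ y ≤ d i := by
  classical
  rcases F.eq_empty_or_nonempty with rfl | hne
  · exact ⟨0, 0, by simp⟩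
  have hn : ∀ i ∈ F, ∀ j ∈ F, a j ≤ b i ∧ c j ≤ d i := by
    intro i hi j hj
    by_cases hij : i = j
    · subst hij; exact ⟨hab i hi, hcd i hi⟩
    by_contra hcon
    have hS : Sep a b c d i j ∧ Sep a b c d j i := by
      unfold Sep
      rw [not_and_or, not_le, not_le] at hcon
      tauto
    have := h {i, j} (by
      intro k hk
      simp only [Finset.mem_insert, Finset.mem_singleton] at hk
      rcases hk with rfl | rfl <;> assumption) (by
      intro k hk l hl hkl
      simp only [Finset.mem_insert, Finset.mem_singleton] at hk hl
      rcases hk with rfl | rfl <;> rcases hl with rfl | rfl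
      · exact absurd rfl hkl
      · exact hS.1
      · exact hS.2
      · exact absurd rfl hkl)
    rw [Finset.card_pair hij] at this
    omega
  obtain ⟨p, hp, hpm⟩ := Finset.exists_max_image F a hne
  obtain ⟨q, hq, hqm⟩ := Finset.exists_max_image F c hne
  exact ⟨a p, c q, fun i hi => ⟨hpm i hi, (hn i hi p hp).1, hqm i hi, (hn i hi q hq).2⟩⟩

lemma Sep.symm' {ι : Type*} {a b c d : ι → ℝ} (i j : ι) (h : Sep a b c d i j) :
    Sep a b c d j i := by
  unfold Sep at *; tauto

/-- Two vertical cuts and then two horizontal cuts of the rectangles meeting the vertical lines. -/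
lemma main {ι : Type*} (a b c d : ι → ℝ) (F : Finset ι)
    (hab : ∀ i ∈ F, a i ≤ b i) (hcd : ∀ i ∈ F, c i ≤ d i)
    (h : NuLe (Sep a b c d) F 5) :
    ∃ S : Finset (ℝ × ℝ), S.card ≤ 10 ∧
      ∀ i ∈ F, ∃ p ∈ S, a i ≤ p.1 ∧ p.1 ≤ b i ∧ c i ≤ p.2 ∧ p.2 ≤ d i := by
  classical
  have hx : ∀ i j, b i < a j → Sep a b c d i j := fun i j h => Or.inl h
  have hy : ∀ i j, d i < c j → Sep a b c d i j := fun i j h => Or.inr (Or.inr (Or.inl h))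
  -- three-way splitting in one coordinate
  have split : ∀ lo hi : ι → ℝ, (∀ i j, hi i < lo j → Sep a b c d i j) →
      ∀ H ⊆ F, (∀ i ∈ H, lo i ≤ hi i) → ∃ s t : ℝ, ∃ p q r : ℝ × ℝ, ∀ i ∈ H,
        (lo i ≤ s ∧ s ≤ hi i) ∨ (lo i ≤ t ∧ t ≤ hi i) ∨
        ∃ z ∈ ({p, q, r} : Finset (ℝ × ℝ)),
          a i ≤ z.1 ∧ z.1 ≤ b i ∧ c i ≤ z.2 ∧ z.2 ≤ d i := by
    intro lo hi hsep H hH hle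
    obtain ⟨s, hs1, hs2⟩ := cut _ Sep.symm' lo hi hsep H hle 5 (h.mono hH)
    obtain ⟨t, ht1, ht2⟩ := cut _ Sep.symm' lo hi hsep _
      (fun i hi => hle i (Finset.mem_filter.1 hi).1) _ hs2
    have sub : ∀ K ⊆ H, NuLe (Sep a b c d) K 1 →
        ∃ x y : ℝ, ∀ i ∈ K, a i ≤ x ∧ x ≤ b i ∧ c i ≤ y ∧ y ≤ d i := fun K hK hN =>
      helly a b c d K (fun i hi => hab i (hH (hK hi))) (fun i hi => hcd i (hH (hK hi))) hN
    obtain ⟨x1, y1, h1⟩ := sub _ (Finset.filter_subset _ _) hs1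
    obtain ⟨x2, y2, h2⟩ := sub _
      ((Finset.filter_subset _ _).trans (Finset.filter_subset _ _)) ht1
    obtain ⟨x3, y3, h3⟩ := sub _
      ((Finset.filter_subset _ _).trans (Finset.filter_subset _ _)) ht2
    simp only [Finset.mem_filter] at h1 h2 h3
    refine ⟨s, t, (x1, y1), (x2, y2), (x3, y3), fun i hiH => ?_⟩
    by_cases c1 : hi i < s
    · exact Or.inr (Or.inr ⟨(x1, y1), by simp, h1 i ⟨hiH, c1⟩⟩)
    by_cases c2 : s < lo i
    · by_cases c3 : hi i < t
      · exact Or.inr (Or.inr ⟨(x2, y2), by simp, h2 i ⟨⟨hiH, c2⟩, c3⟩⟩)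
      by_cases c4 : t < lo i
      · exact Or.inr (Or.inr ⟨(x3, y3), by simp, h3 i ⟨⟨hiH, c2⟩, c4⟩⟩)
      · exact Or.inr (Or.inl ⟨not_lt.1 c4, not_lt.1 c3⟩)
    · exact Or.inl ⟨not_lt.1 c2, not_lt.1 c1⟩
  obtain ⟨s, t, p, q, r, hv⟩ := split a b hx F (Finset.Subset.refl _) hab
  obtain ⟨s', t', p', q', r', hh⟩ := split c d hy
    (F.filter (fun i => (a i ≤ s ∧ s ≤ b i) ∨ (a i ≤ t ∧ t ≤ b i)))
    (Finset.filter_subset _ _) (fun i hi => hcd i (Finset.mem_filter.1 hi).1)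
  refine ⟨({p, q, r} ∪ {p', q', r'}) ∪ {(s, s'), (s, t'), (t, s'), (t, t')}, ?_, ?_⟩
  · have e1 := Finset.card_union_le (({p, q, r} : Finset (ℝ × ℝ)) ∪ {p', q', r'})
      {(s, s'), (s, t'), (t, s'), (t, t')}
    have e2 := Finset.card_union_le ({p, q, r} : Finset (ℝ × ℝ)) {p', q', r'}
    have e3 := Finset.card_le_three (a := p) (b := q) (c := r)
    have e4 := Finset.card_le_three (a := p') (b := q') (c := r')
    have e5 := Finset.card_le_four (a := (s, s')) (b := (s, t')) (c := (t, s')) (d := (t, t'))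
    omega
  · intro i hi
    have grid : ((a i ≤ s ∧ s ≤ b i) ∨ (a i ≤ t ∧ t ≤ b i)) →
        ∃ z ∈ (({p, q, r} : Finset (ℝ × ℝ)) ∪ {p', q', r'}) ∪
          {(s, s'), (s, t'), (t, s'), (t, t')},
          a i ≤ z.1 ∧ z.1 ≤ b i ∧ c i ≤ z.2 ∧ z.2 ≤ d i := by
      intro hg
      rcases hh i (Finset.mem_filter.2 ⟨hi, hg⟩) with k | k | ⟨z, hz, k⟩
      · rcases hg with g | g
        · exact ⟨(s, s'), by simp, g.1, g.2, k.1, k.2⟩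
        · exact ⟨(t, s'), by simp, g.1, g.2, k.1, k.2⟩
      · rcases hg with g | g
        · exact ⟨(s, t'), by simp, g.1, g.2, k.1, k.2⟩
        · exact ⟨(t, t'), by simp, g.1, g.2, k.1, k.2⟩
      · exact ⟨z, Finset.mem_union_left _ (Finset.mem_union_right _ hz), k⟩
    rcases hv i hi with k | k | ⟨z, hz, k⟩
    · exact grid (Or.inl k)
    · exact grid (Or.inr k)
    · exact ⟨z, Finset.mem_union_left _ (Finset.mem_union_left _ hz), k⟩

end BoxPierce

/-- f(5,2) ≤ 10 : any finite family of rectangles in ℝ² with no 6 pairwise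
disjoint members can be pierced by 10 points. -/
theorem fBox_five_two_le_ten : fBox 5 2 ≤ 10 := by
  classical
  unfold fBox
  apply csSup_le'
  rintro n ⟨F, hbox, hnu, rfl⟩
  have hbox' : ∀ B : Set (Fin 2 → ℝ), ∃ l u : Fin 2 → ℝ, B ∈ F → l ≤ u ∧ B = Set.Icc l u := by
    intro B
    by_cases hB : B ∈ F
    · obtain ⟨l, u, h⟩ := hbox B hB
      exact ⟨l, u, fun _ => h⟩
    · exact ⟨0, 0, fun h => absurd h hB⟩
  choose l u hlu using hbox'
  obtain ⟨S, hS, hp⟩ := BoxPierce.main (fun B => l B 0) (fun B => u B 0) (fun B => l B 1)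
    (fun B => u B 1) F (fun B hB => (hlu B hB).1 0) (fun B hB => (hlu B hB).1 1) (by
      intro G hG hD
      refine le_trans ?_ hnu
      unfold nu
      apply le_csSup
      · refine ⟨F.card, ?_⟩
        rintro n ⟨G, hG, rfl, _⟩
        exact Finset.card_le_card hG
      refine ⟨G, hG, rfl, ?_⟩
      · intro A hA B hB hAB
        have hs := hD A hA B hB hAB
        simp only [Function.onFun, id]
        rw [Set.disjoint_left]
        intro x hxA hxB
        rw [(hlu A (hG hA)).2] at hxA
        rw [(hlu B (hG hB)).2] at hxB
        have a0 := hxA.1 0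
        have a1 := hxA.1 1
        have a2 := hxA.2 0
        have a3 := hxA.2 1
        have b0 := hxB.1 0
        have b1 := hxB.1 1
        have b2 := hxB.2 0
        have b3 := hxB.2 1
        rcases hs with h | h | h | h <;> linarith)
  have hle : tau F ≤ (S.image (fun p => (![p.1, p.2] : Fin 2 → ℝ))).card := by
    apply Nat.sInf_le
    refine ⟨_, rfl, ?_⟩
    intro B hB
    obtain ⟨p, hpS, h1, h2, h3, h4⟩ := hp B hB
    refine ⟨_, Finset.mem_image_of_mem _ hpS, ?_⟩
    rw [(hlu B hB).2]
    constructor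
    · intro i
      fin_cases i
      · exact h1
      · exact h3
    · intro i
      fin_cases i
      · exact h2
      · exact h4
  exact hle.trans (Finset.card_image_le.trans hS)
end

section
/- For every finite family 𝓑 of axis-parallel rectangles in ℝ² with ν(𝓑) = n, one has τ(𝓑) ≤ n·log_{9^{1/3}}(n) + n (where the right side is interpreted as 1 for n = 1). -/
/-- `ν(F) ≤ k`, stated directly. -/
def NuLe {α : Type*} (F : Finset (Set α)) (k : ℕ) : Prop :=
  ∀ G ⊆ F, (G : Set (Set α)).PairwiseDisjoint id → G.card ≤ k

/-- `F` is a family of boxes with corner functions `l`, `u`. -/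
def Cor (l u : Set (Fin 2 → ℝ) → Fin 2 → ℝ) (F : Finset (Set (Fin 2 → ℝ))) : Prop :=
  ∀ B ∈ F, l B ≤ u B ∧ B = Set.Icc (l B) (u B)

lemma NuLe.mono {α : Type*} {F F' : Finset (Set α)} {k k' : ℕ} (h : NuLe F k)
    (hF : F' ⊆ F) (hk : k ≤ k') : NuLe F' k' :=
  fun G hG hd => (h G (hG.trans hF) hd).trans hk

lemma NuLe.eq_empty {α : Type*} {F : Finset (Set α)} (h : NuLe F 0) : F = ∅ := by
  classical
  by_contra hne
  obtain ⟨B, hB⟩ := Finset.nonempty_iff_ne_empty.mpr hne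
  have := h {B} (by simpa using hB) (by simp)
  simp at this

lemma Cor.mono {l u : Set (Fin 2 → ℝ) → Fin 2 → ℝ} {F F' : Finset (Set (Fin 2 → ℝ))}
    (h : Cor l u F) (hF : F' ⊆ F) : Cor l u F' := fun B hB => h B (hF hB)

lemma cor_disjoint {l u : Set (Fin 2 → ℝ) → Fin 2 → ℝ} {F : Finset (Set (Fin 2 → ℝ))}
    (h : Cor l u F) {A B : Set (Fin 2 → ℝ)} (hA : A ∈ F) (hB : B ∈ F) (i : Fin 2)
    (hlt : u A i < l B i) : Disjoint A B := by
  rw [Set.disjoint_left]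
  intro x hxA hxB
  rw [(h A hA).2] at hxA
  rw [(h B hB).2] at hxB
  have h1 := hxA.2 i
  have h2 := hxB.1 i
  linarith

lemma split_exists {l u : Set (Fin 2 → ℝ) → Fin 2 → ℝ} {F : Finset (Set (Fin 2 → ℝ))}
    (h : Cor l u F) (i : Fin 2) {n : ℕ} (hn : NuLe F n) (k : ℕ) :
    ∃ t : ℝ, NuLe (F.filter (fun B => u B i < t)) k ∧
      NuLe (F.filter (fun B => t < l B i)) (n - k - 1) := by
  classical
  by_cases hk : NuLe F k
  · obtain ⟨M, hM⟩ := (F.image (fun B => l B i)).bddAbove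
    refine ⟨M, hk.mono (Finset.filter_subset _ _) le_rfl, ?_⟩
    have : F.filter (fun B => M < l B i) = ∅ := by
      apply Finset.filter_eq_empty_iff.mpr
      intro B hB hlt
      have := hM (Finset.mem_coe.mpr (Finset.mem_image_of_mem (fun B => l B i) hB))
      linarith
    rw [this]
    intro G hG _
    rw [Finset.subset_empty.mp hG]
    simp
  · -- a large disjoint family has a maximal upper end
    have key : ∀ F' ⊆ F, ¬ NuLe F' k → ∃ B ∈ F',
        ¬ NuLe (F.filter (fun C => u C i ≤ u B i)) k := by
      intro F' hF' hbad
      unfold NuLe at hbad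
      push Not at hbad
      obtain ⟨G, hGF, hGd, hGc⟩ := hbad
      have hne : G.Nonempty := Finset.card_pos.mp (by omega)
      obtain ⟨B, hB, hmax⟩ := G.exists_max_image (fun B => u B i) hne
      refine ⟨B, hGF hB, fun hN => ?_⟩
      have := hN G (fun C hC => Finset.mem_filter.mpr ⟨hF' (hGF hC), hmax C hC⟩) hGd
      omega
    obtain ⟨B0, hB0, hB0'⟩ := key F subset_rfl hk
    obtain ⟨B, hB, hmin⟩ := (F.filter (fun B =>
        ¬ NuLe (F.filter (fun C => u C i ≤ u B i)) k)).exists_min_image (fun B => u B i)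
        ⟨B0, Finset.mem_filter.mpr ⟨hB0, hB0'⟩⟩
    rw [Finset.mem_filter] at hB
    refine ⟨u B i, ?_, ?_⟩
    · by_contra hbad
      obtain ⟨C, hC, hC'⟩ := key _ (Finset.filter_subset _ _) hbad
      rw [Finset.mem_filter] at hC
      have := hmin C (Finset.mem_filter.mpr ⟨hC.1, hC'⟩)
      linarith [hC.2]
    · intro G hG hGd
      obtain ⟨hBF, hbad⟩ := hB
      unfold NuLe at hbad
      push Not at hbad
      obtain ⟨H, hHF, hHd, hHc⟩ := hbad
      have hH : ∀ C ∈ H, C ∈ F ∧ u C i ≤ u B i := fun C hC => Finset.mem_filter.mp (hHF hC)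
      have hG' : ∀ C ∈ G, C ∈ F ∧ u B i < l C i := fun C hC => Finset.mem_filter.mp (hG hC)
      have hHG : ∀ C ∈ H, ∀ D ∈ G, Disjoint C D := fun C hC D hD =>
        cor_disjoint h (hH C hC).1 (hG' D hD).1 i (lt_of_le_of_lt (hH C hC).2 (hG' D hD).2)
      have hdisj : Disjoint H G := by
        rw [Finset.disjoint_left]
        intro C hC hD
        have h1 := (hH C hC).2
        have h2 := (hG' C hD).2
        have h3 := (h C (hH C hC).1).1 i
        linarith
      have hU := hn (H ∪ G) (Finset.union_subset (fun C hC => (hH C hC).1)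
        (fun C hC => (hG' C hC).1)) (by
          intro C hC D hD hne
          simp only [Finset.coe_union, Set.mem_union, Finset.mem_coe] at hC hD
          rcases hC with hC | hC <;> rcases hD with hD | hD
          · exact hHd hC hD hne
          · exact hHG C hC D hD
          · exact (hHG D hD C hC).symm
          · exact hGd hC hD hne)
      rw [Finset.card_union_of_disjoint hdisj] at hU
      omega

lemma helly_one {l u : Set (Fin 2 → ℝ) → Fin 2 → ℝ} {F : Finset (Set (Fin 2 → ℝ))}
    (h : Cor l u F) (hn : NuLe F 1) :
    ∃ S : Finset (Fin 2 → ℝ), S.card ≤ 1 ∧ Piercing S F := by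
  classical
  by_cases hne : F.Nonempty
  · have hle : ∀ A ∈ F, ∀ B ∈ F, ∀ i, l A i ≤ u B i := by
      intro A hA B hB i
      by_contra hlt
      push Not at hlt
      have hd := cor_disjoint h hB hA i hlt
      have hAB : A ≠ B := by
        rintro rfl
        have := (h A hA).1 i
        linarith
      have := hn {A, B} (by intro C hC; simp at hC; rcases hC with rfl | rfl <;> assumption) (by
        intro C hC D hD hCD
        simp at hC hD
        rcases hC with rfl | rfl <;> rcases hD with rfl | rfl
        · exact absurd rfl hCD
        · exact hd.symm
        · exact hd
        · exact absurd rfl hCD)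
      rw [Finset.card_pair hAB] at this
      omega
    refine ⟨{fun i => F.sup' hne (fun B => l B i)}, by simp, ?_⟩
    intro B hB
    refine ⟨_, Finset.mem_singleton_self _, ?_⟩
    rw [(h B hB).2]
    constructor
    · intro i
      exact Finset.le_sup' (fun B => l B i) hB
    · intro i
      exact Finset.sup'_le _ _ (fun A hA => hle A hA B hB i)
  · rw [Finset.not_nonempty_iff_eq_empty] at hne
    subst hne
    exact ⟨∅, by simp, by intro B hB; simp at hB⟩

/-- Families all of whose members meet one of two vertical lines. -/
lemma two_lines (l u : Set (Fin 2 → ℝ) → Fin 2 → ℝ) (s t : ℝ) (n : ℕ) :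
    ∀ F : Finset (Set (Fin 2 → ℝ)), Cor l u F → NuLe F n →
    (∀ B ∈ F, (l B 0 ≤ s ∧ s ≤ u B 0) ∨ (l B 0 ≤ t ∧ t ≤ u B 0)) →
    ∃ S : Finset (Fin 2 → ℝ), S.card ≤ 3 * n / 2 ∧ Piercing S F := by
  classical
  induction n using Nat.strong_induction_on with
  | _ n ih =>
  intro F h hn hit
  rcases Nat.lt_or_ge n 2 with h2 | h2
  · interval_cases n
    · rw [hn.eq_empty]
      exact ⟨∅, by simp, by intro B hB; simp at hB⟩
    · exact helly_one h hn
  · obtain ⟨y, hlo, hhi⟩ := split_exists h 1 hn 1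
    obtain ⟨S1, hS1, hP1⟩ := helly_one (h.mono (Finset.filter_subset _ _)) hlo
    obtain ⟨S2, hS2, hP2⟩ := ih (n - 1 - 1) (by omega) _ (h.mono (Finset.filter_subset _ _)) hhi
      (fun B hB => hit B (Finset.mem_filter.mp hB).1)
    refine ⟨S1 ∪ S2 ∪ {![s, y], ![t, y]}, ?_, ?_⟩
    · have a1 := Finset.card_union_le (S1 ∪ S2) {![s, y], ![t, y]}
      have a2 := Finset.card_union_le S1 S2
      have a3 : ({![s, y], ![t, y]} : Finset (Fin 2 → ℝ)).card ≤ 2 := Finset.card_le_two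
      omega
    · intro B hB
      by_cases c1 : u B 1 < y
      · obtain ⟨p, hp, hpB⟩ := hP1 B (Finset.mem_filter.mpr ⟨hB, c1⟩)
        exact ⟨p, by simp [hp], hpB⟩
      by_cases c2 : y < l B 1
      · obtain ⟨p, hp, hpB⟩ := hP2 B (Finset.mem_filter.mpr ⟨hB, c2⟩)
        exact ⟨p, by simp [hp], hpB⟩
      push Not at c1 c2
      rcases hit B hB with hx | hx
      · refine ⟨![s, y], by simp, ?_⟩
        rw [(h B hB).2]
        constructor <;> intro i <;> fin_cases i <;> simp [hx.1, hx.2, c1, c2]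
      · refine ⟨![t, y], by simp, ?_⟩
        rw [(h B hB).2]
        constructor <;> intro i <;> fin_cases i <;> simp [hx.1, hx.2, c1, c2]

/-- The three-way recursion. -/
lemma three_parts {l u : Set (Fin 2 → ℝ) → Fin 2 → ℝ} (n m : ℕ)
    (ih : ∀ F : Finset (Set (Fin 2 → ℝ)), Cor l u F → NuLe F (n / 3) →
      ∃ S : Finset (Fin 2 → ℝ), S.card ≤ m ∧ Piercing S F)
    (F : Finset (Set (Fin 2 → ℝ))) (h : Cor l u F) (hn : NuLe F n) :
    ∃ S : Finset (Fin 2 → ℝ), S.card ≤ 3 * n / 2 + 3 * m ∧ Piercing S F := by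
  classical
  obtain ⟨s, hs1, hs2⟩ := split_exists h 0 hn (n / 3)
  have hR : Cor l u (F.filter (fun B => s < l B 0)) := h.mono (Finset.filter_subset _ _)
  obtain ⟨t, ht1, ht2⟩ := split_exists hR 0 hs2 (n / 3)
  obtain ⟨S1, hS1, hP1⟩ := ih _ (h.mono (Finset.filter_subset _ _)) hs1
  obtain ⟨S2, hS2, hP2⟩ := ih _ (hR.mono (Finset.filter_subset _ _)) ht1
  obtain ⟨S3, hS3, hP3⟩ := ih _ (hR.mono (Finset.filter_subset _ _))
    (ht2.mono subset_rfl (by omega))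
  obtain ⟨S4, hS4, hP4⟩ := two_lines l u s t n
    (F.filter (fun B => (l B 0 ≤ s ∧ s ≤ u B 0) ∨ (l B 0 ≤ t ∧ t ≤ u B 0)))
    (h.mono (Finset.filter_subset _ _)) (hn.mono (Finset.filter_subset _ _) le_rfl)
    (fun B hB => (Finset.mem_filter.mp hB).2)
  refine ⟨S1 ∪ S2 ∪ S3 ∪ S4, ?_, ?_⟩
  · have a1 := Finset.card_union_le (S1 ∪ S2 ∪ S3) S4
    have a2 := Finset.card_union_le (S1 ∪ S2) S3
    have a3 := Finset.card_union_le S1 S2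
    omega
  · intro B hB
    by_cases c1 : u B 0 < s
    · obtain ⟨p, hp, hpB⟩ := hP1 B (Finset.mem_filter.mpr ⟨hB, c1⟩)
      exact ⟨p, by simp [hp], hpB⟩
    by_cases c2 : l B 0 ≤ s
    · obtain ⟨p, hp, hpB⟩ := hP4 B (Finset.mem_filter.mpr ⟨hB, Or.inl ⟨c2, not_lt.mp c1⟩⟩)
      exact ⟨p, by simp [hp], hpB⟩
    have hBR : B ∈ F.filter (fun B => s < l B 0) := Finset.mem_filter.mpr ⟨hB, not_le.mp c2⟩
    by_cases c3 : u B 0 < t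
    · obtain ⟨p, hp, hpB⟩ := hP2 B (Finset.mem_filter.mpr ⟨hBR, c3⟩)
      exact ⟨p, by simp [hp], hpB⟩
    by_cases c4 : l B 0 ≤ t
    · obtain ⟨p, hp, hpB⟩ := hP4 B (Finset.mem_filter.mpr ⟨hB, Or.inr ⟨c4, not_lt.mp c3⟩⟩)
      exact ⟨p, by simp [hp], hpB⟩
    · obtain ⟨p, hp, hpB⟩ := hP3 B (Finset.mem_filter.mpr ⟨hBR, not_le.mp c4⟩)
      exact ⟨p, by simp [hp], hpB⟩

lemma logb_base (x : ℝ) : Real.logb ((9 : ℝ) ^ ((1 : ℝ) / 3)) x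
    = 3 / 2 * (Real.log x / Real.log 3) := by
  have h9 : Real.log 9 = 2 * Real.log 3 := by
    rw [show (9 : ℝ) = 3 ^ 2 by norm_num, Real.log_pow]
    norm_num
  have h3 : Real.log 3 ≠ 0 := (Real.log_pos (by norm_num)).ne'
  rw [Real.logb, Real.log_rpow (by norm_num), h9]
  field_simp

/-- The recursion inequality for the bound. -/
lemma bound_rec (n : ℕ) (h2 : 2 ≤ n) :
    (3 * n / 2 : ℝ) + 3 * ((n / 3 : ℕ) * (3 / 2 * (Real.log (n / 3 : ℕ) / Real.log 3))
      + (n / 3 : ℕ)) ≤ n * (3 / 2 * (Real.log n / Real.log 3)) + n := by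
  have h3 : 0 < Real.log 3 := Real.log_pos (by norm_num)
  have hnpos : (0 : ℝ) < n := by exact_mod_cast (by omega : 0 < n)
  rcases Nat.lt_or_ge n 3 with hn | hn
  · obtain rfl : n = 2 := by omega
    have : (1 : ℝ) / 3 ≤ Real.log 2 / Real.log 3 := by
      rw [div_le_div_iff₀ (by norm_num) h3]
      have : Real.log 3 ≤ Real.log (2 ^ 3) := Real.log_le_log (by norm_num) (by norm_num)
      rw [Real.log_pow] at this
      push_cast at this
      linarith
    norm_num
    linarith
  · have hk1 : 1 ≤ n / 3 := by omega
    have hk3 : 3 * (n / 3) ≤ n := by omega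
    generalize n / 3 = k at *
    have hk1' : (1 : ℝ) ≤ k := by exact_mod_cast hk1
    have hk3' : 3 * (k : ℝ) ≤ n := by exact_mod_cast hk3
    have hlog : Real.log k / Real.log 3 + 1 ≤ Real.log n / Real.log 3 := by
      rw [div_add_one h3.ne']
      apply div_le_div_of_nonneg_right _ h3.le
      rw [← Real.log_mul (by positivity) (by norm_num)]
      exact Real.log_le_log (by positivity) (by linarith)
    have hk0 : 0 ≤ Real.log k / Real.log 3 := div_nonneg (Real.log_nonneg hk1') h3.le
    generalize Real.log k / Real.log 3 = a at *
    generalize Real.log n / Real.log 3 = b at *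
    have e1 : (n : ℝ) * (a + 1) ≤ n * b := mul_le_mul_of_nonneg_left hlog hnpos.le
    have e2 : 3 * (k : ℝ) * a ≤ n * a := mul_le_mul_of_nonneg_right hk3' hk0
    linarith

lemma main_bound (l u : Set (Fin 2 → ℝ) → Fin 2 → ℝ) (n : ℕ) :
    ∃ m : ℕ, (m : ℝ) ≤ n * (3 / 2 * (Real.log n / Real.log 3)) + n ∧
    ∀ F : Finset (Set (Fin 2 → ℝ)), Cor l u F → NuLe F n →
    ∃ S : Finset (Fin 2 → ℝ), S.card ≤ m ∧ Piercing S F := by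
  induction n using Nat.strong_induction_on with
  | _ n ih =>
  rcases Nat.lt_or_ge n 2 with h2 | h2
  · interval_cases n
    · refine ⟨0, by simp, fun F h hn => ?_⟩
      rw [hn.eq_empty]
      exact ⟨∅, by simp, by intro B hB; simp at hB⟩
    · exact ⟨1, by simp, fun F h hn => helly_one h hn⟩
  · obtain ⟨m, hm, hF⟩ := ih (n / 3) (by omega)
    refine ⟨3 * n / 2 + 3 * m, ?_, three_parts n m hF⟩
    have hb := bound_rec n h2
    have hd : ((3 * n / 2 : ℕ) : ℝ) ≤ 3 * n / 2 := by
      have := @Nat.cast_div_le ℝ _ _ _ (3 * n) 2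
      push_cast at this
      exact this
    push_cast at hd ⊢
    linarith

/-- Proposition 3: for any finite family of rectangles in ℝ²,
τ(𝓑) ≤ ν(𝓑)·log_{9^{1/3}}(ν(𝓑)) + ν(𝓑)  (the right side being 1 when ν = 1). -/
theorem tau_le_nu_logb (F : Finset (Set (Fin 2 → ℝ)))
    (hF : ∀ B ∈ F, IsBox 2 B) (n : ℕ) (hn : nu F = n) (hn1 : 1 ≤ n) :
    (tau F : ℝ) ≤ n * Real.logb ((9 : ℝ) ^ ((1 : ℝ) / 3)) n + n := by
  classical
  have hex : ∀ B : Set (Fin 2 → ℝ), ∃ l u : Fin 2 → ℝ, B ∈ F → l ≤ u ∧ B = Set.Icc l u := by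
    intro B
    by_cases hB : B ∈ F
    · obtain ⟨l, u, h⟩ := hF B hB
      exact ⟨l, u, fun _ => h⟩
    · exact ⟨0, 0, fun h => absurd h hB⟩
  choose l u hlu using hex
  have hN : NuLe F n := by
    intro G hG hd
    rw [← hn]
    refine le_csSup ⟨F.card, ?_⟩ ⟨G, hG, rfl, hd⟩
    rintro k ⟨H, hH, rfl, -⟩
    exact Finset.card_le_card hH
  obtain ⟨m, hm, hall⟩ := main_bound l u n
  obtain ⟨S, hS, hP⟩ := hall F hlu hN
  have ht : tau F ≤ S.card := Nat.sInf_le ⟨S, rfl, hP⟩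
  rw [logb_base]
  exact le_trans (by exact_mod_cast ht.trans hS) hm
end
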